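/- The following limits inferior (as n → ∞, with log_n x = ln x / ln n) all equal liminf_n log_n R(M_n): liminf_n log_n R(sM^Z_n), liminf_n log_n R_s(sM^Z_n), liminf_n log_n uR(sM^Z_n), and liminf_n log_n uR_s(sM^Z_n). In other words, the exponent of matrix multiplication can be computed from the rank, border rank, symmetric rank, or symmetric border rank of the restriction of sM_n to symmetric matrices with zero diagonal. -/

import Mathlib

open Filter Matrix

/-- Tensor rank of a trilinear form on a complex vector space `W`: the smallest `r`
such that `t(a,b,c) = ∑ i, f i a * g i b * h i c` for linear functionals `f i, g i, h i`. -/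
noncomputable def tensorRank {W : Type*} [AddCommGroup W] [Module ℂ W]
    (t : W → W → W → ℂ) : ℕ :=
  sInf {r : ℕ | ∃ f g h : Fin r → (W →ₗ[ℂ] ℂ),
    ∀ a b c, t a b c = ∑ i, f i a * g i b * h i c}

/-- Border rank of a trilinear form: the smallest `r` such that `t` is a limit of
trilinear forms of tensor rank at most `r` (pointwise convergence, which on the
finite-dimensional space of trilinear forms agrees with the usual topology). -/
noncomputable def borderRank {W : Type*} [AddCommGroup W] [Module ℂ W]
    (t : W → W → W → ℂ) : ℕ :=
  sInf {r : ℕ | ∃ f g h : ℕ → Fin r → (W →ₗ[ℂ] ℂ),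
    ∀ a b c, Tendsto (fun m => ∑ i, f m i a * g m i b * h m i c) atTop (nhds (t a b c))}

/-- Symmetric (Waring) rank of a cubic polynomial: the smallest `r` such that
`P = ℓ₁³ + ⋯ + ℓᵣ³` for linear forms `ℓᵢ`. -/
noncomputable def symRank {W : Type*} [AddCommGroup W] [Module ℂ W]
    (P : W → ℂ) : ℕ :=
  sInf {r : ℕ | ∃ ℓ : Fin r → (W →ₗ[ℂ] ℂ), ∀ a, P a = ∑ i, (ℓ i a) ^ 3}

/-- Symmetric border rank of a cubic polynomial: the smallest `r` such that `P` is a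
limit of cubics of symmetric rank at most `r` (pointwise convergence, which on the
finite-dimensional space of cubics agrees with the usual topology). -/
noncomputable def symBorderRank {W : Type*} [AddCommGroup W] [Module ℂ W]
    (P : W → ℂ) : ℕ :=
  sInf {r : ℕ | ∃ ℓ : ℕ → Fin r → (W →ₗ[ℂ] ℂ),
    ∀ a, Tendsto (fun m => ∑ i, (ℓ m i a) ^ 3) atTop (nhds (P a))}

/-- The matrix multiplication tensor `M_n(A,B,C) = trace(ABC)`. -/
noncomputable def matMulTensor (n : ℕ) :
    Matrix (Fin n) (Fin n) ℂ → Matrix (Fin n) (Fin n) ℂ → Matrix (Fin n) (Fin n) ℂ → ℂ :=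
  fun A B C => (A * B * C).trace

/-- The space `Z_n` of symmetric n×n complex matrices with zero diagonal. -/
noncomputable def zeroDiagSym (n : ℕ) : Submodule ℂ (Matrix (Fin n) (Fin n) ℂ) where
  carrier := {A | Aᵀ = A ∧ ∀ i, A i i = 0}
  add_mem' := by
    intro a b ha hb
    refine ⟨by rw [Matrix.transpose_add, ha.1, hb.1], fun i => ?_⟩
    simp [ha.2 i, hb.2 i]
  zero_mem' := by simp
  smul_mem' := by
    intro c A hA
    refine ⟨by rw [Matrix.transpose_smul, hA.1], fun i => ?_⟩
    simp [hA.2 i]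

/-- `sM^Z_n`: the restriction of `sM_n` to symmetric matrices with zero diagonal. -/
noncomputable def sMZ (n : ℕ) : zeroDiagSym n → ℂ :=
  fun A => ((A : Matrix (Fin n) (Fin n) ℂ) ^ 3).trace

/-- The symmetric trilinear form (polarization) associated to `sM^Z_n`. -/
noncomputable def sMZTensor (n : ℕ) : zeroDiagSym n → zeroDiagSym n → zeroDiagSym n → ℂ :=
  fun A B C => (1/2 : ℂ) *
    (((A : Matrix (Fin n) (Fin n) ℂ) * B * C).trace +
      ((B : Matrix (Fin n) (Fin n) ℂ) * A * C).trace)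


def HasRk {W : Type*} [AddCommGroup W] [Module ℂ W] (t : W → W → W → ℂ) (r : ℕ) : Prop :=
  ∃ f g h : Fin r → (W →ₗ[ℂ] ℂ), ∀ a b c, t a b c = ∑ i, f i a * g i b * h i c

def HasBRk {W : Type*} [AddCommGroup W] [Module ℂ W] (t : W → W → W → ℂ) (r : ℕ) : Prop :=
  ∃ f g h : ℕ → Fin r → (W →ₗ[ℂ] ℂ),
    ∀ a b c, Tendsto (fun m => ∑ i, f m i a * g m i b * h m i c) atTop (nhds (t a b c))

def HasSRk {W : Type*} [AddCommGroup W] [Module ℂ W] (P : W → ℂ) (r : ℕ) : Prop :=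
  ∃ ℓ : Fin r → (W →ₗ[ℂ] ℂ), ∀ a, P a = ∑ i, (ℓ i a) ^ 3

def HasSBRk {W : Type*} [AddCommGroup W] [Module ℂ W] (P : W → ℂ) (r : ℕ) : Prop :=
  ∃ ℓ : ℕ → Fin r → (W →ₗ[ℂ] ℂ),
    ∀ a, Tendsto (fun m => ∑ i, (ℓ m i a) ^ 3) atTop (nhds (P a))

section basics
variable {W : Type*} [AddCommGroup W] [Module ℂ W]

lemma tensorRank_le {t : W → W → W → ℂ} {r : ℕ} (h : HasRk t r) : tensorRank t ≤ r :=
  Nat.sInf_le h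
lemma borderRank_le {t : W → W → W → ℂ} {r : ℕ} (h : HasBRk t r) : borderRank t ≤ r :=
  Nat.sInf_le h
lemma symRank_le {P : W → ℂ} {r : ℕ} (h : HasSRk P r) : symRank P ≤ r :=
  Nat.sInf_le h
lemma symBorderRank_le {P : W → ℂ} {r : ℕ} (h : HasSBRk P r) : symBorderRank P ≤ r :=
  Nat.sInf_le h
lemma tensorRank_spec {t : W → W → W → ℂ} {r : ℕ} (h : HasRk t r) : HasRk t (tensorRank t) :=
  Nat.sInf_mem (s := {r | HasRk t r}) ⟨r, h⟩
lemma borderRank_spec {t : W → W → W → ℂ} {r : ℕ} (h : HasBRk t r) : HasBRk t (borderRank t) :=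
  Nat.sInf_mem (s := {r | HasBRk t r}) ⟨r, h⟩
lemma symRank_spec {P : W → ℂ} {r : ℕ} (h : HasSRk P r) : HasSRk P (symRank P) :=
  Nat.sInf_mem (s := {r | HasSRk P r}) ⟨r, h⟩
lemma symBorderRank_spec {P : W → ℂ} {r : ℕ} (h : HasSBRk P r) :
    HasSBRk P (symBorderRank P) :=
  Nat.sInf_mem (s := {r | HasSBRk P r}) ⟨r, h⟩

lemma HasRk.border {t : W → W → W → ℂ} {r : ℕ} (h : HasRk t r) : HasBRk t r := by
  obtain ⟨f, g, h, H⟩ := h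
  refine ⟨fun _ => f, fun _ => g, fun _ => h, fun a b c => ?_⟩
  rw [H]; exact tendsto_const_nhds

lemma HasSRk.border {P : W → ℂ} {r : ℕ} (h : HasSRk P r) : HasSBRk P r := by
  obtain ⟨f, H⟩ := h
  refine ⟨fun _ => f, fun a => ?_⟩
  rw [H]; exact tendsto_const_nhds

lemma hasRk_of_fintype {κ : Type*} [Fintype κ] {t : W → W → W → ℂ} {r : ℕ}
    (hr : Fintype.card κ = r) (f g h : κ → (W →ₗ[ℂ] ℂ))
    (H : ∀ a b c, t a b c = ∑ i, f i a * g i b * h i c) : HasRk t r := by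
  let e := Fintype.equivFinOfCardEq hr
  refine ⟨f ∘ e.symm, g ∘ e.symm, h ∘ e.symm, fun a b c => ?_⟩
  rw [H]
  exact (Equiv.sum_comp e.symm (fun i => f i a * g i b * h i c)).symm

lemma hasSRk_of_fintype {κ : Type*} [Fintype κ] {P : W → ℂ} {r : ℕ}
    (hr : Fintype.card κ = r) (f : κ → (W →ₗ[ℂ] ℂ))
    (H : ∀ a, P a = ∑ i, (f i a) ^ 3) : HasSRk P r := by
  let e := Fintype.equivFinOfCardEq hr
  refine ⟨f ∘ e.symm, fun a => ?_⟩
  rw [H]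
  exact (Equiv.sum_comp e.symm (fun i => (f i a) ^ 3)).symm
end basics

lemma matMul_hasRk (n : ℕ) : HasRk (matMulTensor n) (n ^ 3) := by
  refine hasRk_of_fintype (κ := Fin n × Fin n × Fin n) (by simp; ring)
    (fun p => Matrix.entryLinearMap ℂ ℂ p.1 p.2.1)
    (fun p => Matrix.entryLinearMap ℂ ℂ p.2.1 p.2.2)
    (fun p => Matrix.entryLinearMap ℂ ℂ p.2.2 p.1) ?_
  intro A B C
  simp only [matMulTensor, Matrix.trace, Matrix.diag, Matrix.mul_apply, Fintype.sum_prod_type,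
    Matrix.entryLinearMap_apply, Finset.sum_mul]
  refine Finset.sum_congr rfl fun i _ => ?_
  rw [Finset.sum_comm]

lemma sMZ_hasSRk {n r : ℕ} (h : HasRk (matMulTensor n) r) : HasSRk (sMZ n) (4 * r) := by
  obtain ⟨f, g, h, H⟩ := h
  obtain ⟨z, hz⟩ := IsAlgClosed.exists_pow_nat_eq (1 / 24 : ℂ) (n := 3) (by norm_num)
  let S := (zeroDiagSym n).subtype
  refine hasSRk_of_fintype (κ := Fin r × Fin 4) (by simp; ring)
    (fun p => z • ![(f p.1 + g p.1 + h p.1) ∘ₗ S, (f p.1 - g p.1 - h p.1) ∘ₗ S,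
      (- f p.1 + g p.1 - h p.1) ∘ₗ S, (- f p.1 - g p.1 + h p.1) ∘ₗ S] p.2) ?_
  intro A
  have := H A A A
  simp only [matMulTensor] at this
  simp only [sMZ, pow_three', this, Fintype.sum_prod_type, Fin.sum_univ_four]
  refine Finset.sum_congr rfl fun i _ => ?_
  simp [S]
  linear_combination (-24 * f i A * g i A * h i A) * hz

lemma sMZTensor_hasRk {n r : ℕ} (h : HasRk (matMulTensor n) r) :
    HasRk (sMZTensor n) (2 * r) := by
  obtain ⟨f, g, h, H⟩ := h
  let S := (zeroDiagSym n).subtype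
  refine hasRk_of_fintype (κ := Fin r ⊕ Fin r) (by simp; ring)
    (Sum.elim (fun i => f i ∘ₗ S) (fun i => g i ∘ₗ S))
    (Sum.elim (fun i => g i ∘ₗ S) (fun i => f i ∘ₗ S))
    (Sum.elim (fun i => (1 / 2 : ℂ) • h i ∘ₗ S) (fun i => (1 / 2 : ℂ) • h i ∘ₗ S)) ?_
  intro A B C
  have h1 := H A B C
  have h2 := H B A C
  simp only [matMulTensor] at h1 h2
  simp only [sMZTensor, h1, h2, Fintype.sum_sum_type, mul_add, Finset.mul_sum]
  congr 1 <;> refine Finset.sum_congr rfl fun i _ => ?_ <;> simp [S] <;> ring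

lemma sMZTensor_polar (n : ℕ) (A B C : zeroDiagSym n) :
    sMZTensor n A B C = (1 / 6 : ℂ) * (sMZ n (A + B + C) - sMZ n (A + B) - sMZ n (A + C)
      - sMZ n (B + C) + sMZ n A + sMZ n B + sMZ n C) := by
  obtain ⟨A, hA⟩ := A
  obtain ⟨B, hB⟩ := B
  obtain ⟨C, hC⟩ := C
  simp only [sMZTensor, sMZ, Submodule.coe_add, pow_three', Matrix.add_mul, Matrix.mul_add,
    Matrix.trace_add]
  have e1 : (B * C * A).trace = (A * B * C).trace := by
    rw [Matrix.trace_mul_comm, Matrix.mul_assoc]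
  have e2 : (C * A * B).trace = (A * B * C).trace := by
    rw [Matrix.mul_assoc, Matrix.trace_mul_comm]
  have e3 : (A * C * B).trace = (B * A * C).trace := by
    rw [Matrix.trace_mul_comm, Matrix.mul_assoc]
  have e4 : (C * B * A).trace = (B * A * C).trace := by
    rw [Matrix.mul_assoc, Matrix.trace_mul_comm]
  rw [e1, e2, e3, e4]
  ring

lemma sMZ_border_polar {n r : ℕ} (h : HasSBRk (sMZ n) r) : HasBRk (sMZTensor n) r := by
  obtain ⟨f, H⟩ := h
  refine ⟨f, f, f, fun A B C => ?_⟩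
  rw [sMZTensor_polar]
  have := ((((((H (A + B + C)).sub (H (A + B))).sub (H (A + C))).sub (H (B + C))).add
    (H A)).add (H B)).add (H C) |>.const_mul (1 / 6 : ℂ)
  refine this.congr fun m => ?_
  simp only [← Finset.sum_sub_distrib, ← Finset.sum_add_distrib, Finset.mul_sum, map_add]
  refine Finset.sum_congr rfl fun i _ => ?_
  ring

/-- Selection matrix of an injective-type map. -/
def selMat {N m : ℕ} (e : Fin m → Fin N) : Matrix (Fin N) (Fin m) ℂ :=
  fun k i => if k = e i then 1 else 0

lemma selMat_self {N m : ℕ} (e : Fin m → Fin N) (he : Function.Injective e) :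
    (selMat e)ᵀ * selMat e = 1 := by
  ext i j
  simp [selMat, Matrix.mul_apply, Matrix.one_apply, he.eq_iff, eq_comm]

lemma selMat_ne {N m : ℕ} (e e' : Fin m → Fin N) (he : ∀ i j, e i ≠ e' j) :
    (selMat e)ᵀ * selMat e' = 0 := by
  ext i j
  simp [selMat, Matrix.mul_apply, (he i j).symm]

/-- Embedding of a matrix as a symmetric off-diagonal block. -/
def blockEmb {N m : ℕ} (e e' : Fin m → Fin N) (he : ∀ i j, e i ≠ e' j) :
    Matrix (Fin m) (Fin m) ℂ →ₗ[ℂ] zeroDiagSym N where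
  toFun A := ⟨selMat e * A * (selMat e')ᵀ + selMat e' * Aᵀ * (selMat e)ᵀ, by
    constructor
    · simp only [Matrix.transpose_add, Matrix.transpose_mul, Matrix.transpose_transpose,
        Matrix.mul_assoc]
      rw [add_comm]
    · intro k
      have : ∀ i j, k = e i → k = e' j → False := fun i j h1 h2 => he i j (h1 ▸ h2)
      simp only [Matrix.add_apply, Matrix.mul_apply, Matrix.transpose_apply, selMat,
        Finset.sum_mul]
      have h1 : ∀ i j : Fin m, ∀ x : ℂ, (if k = e i then (1:ℂ) else 0) * x *
          (if k = e' j then (1:ℂ) else 0) = 0 := by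
        intro i j x
        have := this i j
        by_cases h1 : k = e i
        · have h2 : k ≠ e' j := fun h2 => this h1 h2
          rw [if_neg h2, mul_zero]
        · rw [if_neg h1, zero_mul, zero_mul]
      have h2 : ∀ i j : Fin m, ∀ x : ℂ, (if k = e' i then (1:ℂ) else 0) * x *
          (if k = e j then (1:ℂ) else 0) = 0 := by
        intro i j x
        have := this j i
        by_cases h1 : k = e' i
        · have h2 : k ≠ e j := fun h2 => this h2 h1
          rw [if_neg h2, mul_zero]
        · rw [if_neg h1, zero_mul, zero_mul]
      simp [h1, h2, -mul_ite, -ite_mul]⟩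
  map_add' A B := by
    ext1
    simp only [Matrix.transpose_add, Matrix.mul_add, Matrix.add_mul, Submodule.coe_add]
    abel
  map_smul' c A := by
    ext1
    simp [Matrix.transpose_smul]

lemma block_trace {N m : ℕ} (P Q R : Matrix (Fin N) (Fin m) ℂ)
    (pp : Pᵀ * P = 1) (qq : Qᵀ * Q = 1) (rr : Rᵀ * R = 1)
    (pq : Pᵀ * Q = 0) (pr : Pᵀ * R = 0) (qp : Qᵀ * P = 0) (qr : Qᵀ * R = 0)
    (rp : Rᵀ * P = 0) (rq : Rᵀ * Q = 0) (A B C : Matrix (Fin m) (Fin m) ℂ) :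
    ((P * A * Qᵀ + Q * Aᵀ * Pᵀ) * (Q * B * Rᵀ + R * Bᵀ * Qᵀ) *
      (R * C * Pᵀ + P * Cᵀ * Rᵀ)).trace = (A * B * C).trace ∧
    ((Q * B * Rᵀ + R * Bᵀ * Qᵀ) * (P * A * Qᵀ + Q * Aᵀ * Pᵀ) *
      (R * C * Pᵀ + P * Cᵀ * Rᵀ)).trace = (A * B * C).trace := by
  have key : ∀ (X Y : Matrix (Fin N) (Fin m) ℂ) (Z : Matrix (Fin m) (Fin m) ℂ)
      (U : Matrix (Fin m) (Fin N) ℂ),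
      Xᵀ * Y = Z → Xᵀ * (Y * U) = Z * U := by
    intro X Y Z U h
    rw [← Matrix.mul_assoc, h]
  have k1 := fun T => key P P _ T pp
  have k2 := fun T => key Q Q _ T qq
  have k3 := fun T => key R R _ T rr
  have k4 := fun T => key P Q _ T pq
  have k5 := fun T => key P R _ T pr
  have k6 := fun T => key Q P _ T qp
  have k7 := fun T => key Q R _ T qr
  have k8 := fun T => key R P _ T rp
  have k9 := fun T => key R Q _ T rq
  constructor
  · simp only [Matrix.add_mul, Matrix.mul_add, Matrix.mul_assoc, k1, k2, k3, k4, k5, k6, k7, k8,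
      k9, Matrix.zero_mul, Matrix.mul_zero, Matrix.one_mul, add_zero, zero_add]
    rw [Matrix.trace_mul_comm]
    simp only [Matrix.mul_assoc, pp, Matrix.mul_one]
  · simp only [Matrix.add_mul, Matrix.mul_add, Matrix.mul_assoc, k1, k2, k3, k4, k5, k6, k7, k8,
      k9, Matrix.zero_mul, Matrix.mul_zero, Matrix.one_mul, add_zero, zero_add]
    rw [Matrix.trace_mul_comm]
    simp only [Matrix.mul_assoc, rr, Matrix.mul_one]
    rw [← Matrix.trace_transpose]
    simp only [Matrix.transpose_mul, Matrix.transpose_transpose]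
    rw [Matrix.mul_assoc, Matrix.trace_mul_comm, Matrix.mul_assoc]

lemma matMul_border_of_sMZ {m N r : ℕ} (hN : 3 * m ≤ N) (h : HasBRk (sMZTensor N) r) :
    HasBRk (matMulTensor m) r := by
  obtain ⟨f, g, h, H⟩ := h
  let e1 : Fin m → Fin N := fun i => ⟨i, by omega⟩
  let e2 : Fin m → Fin N := fun i => ⟨m + i, by omega⟩
  let e3 : Fin m → Fin N := fun i => ⟨2 * m + i, by omega⟩
  have i1 : Function.Injective e1 := fun i j hij => by
    simp only [e1, Fin.mk.injEq] at hij; omega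
  have i2 : Function.Injective e2 := fun i j hij => by
    simp only [e2, Fin.mk.injEq] at hij; omega
  have i3 : Function.Injective e3 := fun i j hij => by
    simp only [e3, Fin.mk.injEq] at hij; omega
  have h12 : ∀ i j, e1 i ≠ e2 j := fun i j hij => by
    simp only [e1, e2, Fin.mk.injEq] at hij; omega
  have h23 : ∀ i j, e2 i ≠ e3 j := fun i j hij => by
    simp only [e3, e2, Fin.mk.injEq] at hij; omega
  have h31 : ∀ i j, e3 i ≠ e1 j := fun i j hij => by
    simp only [e3, e1, Fin.mk.injEq] at hij; omega
  let φ := blockEmb e1 e2 h12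
  let ψ := blockEmb e2 e3 h23
  let χ := blockEmb e3 e1 h31
  refine ⟨fun m i => f m i ∘ₗ φ, fun m i => g m i ∘ₗ ψ, fun m i => h m i ∘ₗ χ, fun A B C => ?_⟩
  have key : matMulTensor m A B C = sMZTensor N (φ A) (ψ B) (χ C) := by
    obtain ⟨t1, t2⟩ := block_trace (selMat e1) (selMat e2) (selMat e3) (selMat_self _ i1)
      (selMat_self _ i2) (selMat_self _ i3) (selMat_ne _ _ h12)
      (selMat_ne _ _ fun i j => (h31 j i).symm) (selMat_ne _ _ fun i j => (h12 j i).symm)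
      (selMat_ne _ _ h23) (selMat_ne _ _ h31) (selMat_ne _ _ fun i j => (h23 j i).symm) A B C
    simp only [matMulTensor, sMZTensor, φ, ψ, χ, blockEmb, LinearMap.coe_mk, AddHom.coe_mk]
    rw [t1, t2]
    ring
  rw [key]
  exact H (φ A) (ψ B) (χ C)

lemma power_span {D : Type*} [Fintype D] [DecidableEq D] (S : Set (D → ℂ)) (t : D → ℂ)
    (ht : t ∈ closure S) (k : ℕ) :
    ∃ N ≤ (k + 1) ^ Fintype.card D, ∃ (c : Fin N → ℂ) (s : Fin N → D → ℂ),
      (∀ i, s i ∈ S) ∧ ∀ δ : Fin k → D, ∏ j, t (δ j) = ∑ i, c i * ∏ j, s i (δ j) := by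
  let v : (D → ℂ) → ((D → Fin (k + 1)) → ℂ) := fun s c => ∏ d, s d ^ (c d : ℕ)
  have hv : Continuous v := by
    refine continuous_pi fun c => continuous_finsetProd _ fun d _ => ?_
    exact (continuous_apply d).pow _
  have hmem : v t ∈ Submodule.span ℂ (v '' S) := by
    have h1 : v t ∈ closure (v '' S) := image_closure_subset_closure_image hv ⟨t, ht, rfl⟩
    have h2 : IsClosed (Submodule.span ℂ (v '' S) : Set ((D → Fin (k + 1)) → ℂ)) :=
      Submodule.closed_of_finiteDimensional _
    exact closure_minimal Submodule.subset_span h2 h1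
  obtain ⟨y, hyS, hspan, -⟩ := Submodule.exists_fun_fin_finrank_span_eq ℂ (v '' S)
  rw [← hspan, Submodule.mem_span_range_iff_exists_fun] at hmem
  obtain ⟨c, hc⟩ := hmem
  choose s hsS hs using hyS
  refine ⟨_, ?_, c, s, hsS, ?_⟩
  · refine (Submodule.finrank_le _).trans ?_
    simp [Module.finrank_fintype_fun_eq_card]
  · intro δ
    let e : D → Fin (k + 1) := fun d =>
      ⟨(Finset.univ.filter fun j => δ j = d).card, by
        have := Finset.card_filter_le (Finset.univ : Finset (Fin k)) (fun j => δ j = d)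
        simp only [Finset.card_univ, Fintype.card_fin] at this
        omega⟩
    have key : ∀ u : D → ℂ, ∏ j, u (δ j) = v u e := by
      intro u
      rw [← Finset.prod_fiberwise (s := Finset.univ) (g := δ)]
      refine Finset.prod_congr rfl fun d _ => ?_
      rw [Finset.prod_congr rfl (g := fun _ => u d), Finset.prod_const]
      intro j hj
      rw [(Finset.mem_filter.mp hj).2]
    rw [key, ← hc]
    simp only [Finset.sum_apply, Pi.smul_apply, smul_eq_mul]
    refine Finset.sum_congr rfl fun i _ => ?_
    rw [key, hs]

abbrev IdxP (n : ℕ) := Fin n × Fin n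

/-- Coordinates of the matrix multiplication tensor. -/
def mmCoord (n : ℕ) (d : IdxP n × IdxP n × IdxP n) : ℂ :=
  if d.1.2 = d.2.1.1 ∧ d.2.1.2 = d.2.2.1 ∧ d.2.2.2 = d.1.1 then 1 else 0

lemma matMul_single (n : ℕ) (p q u : IdxP n) :
    matMulTensor n (Matrix.single p.1 p.2 1) (Matrix.single q.1 q.2 1)
      (Matrix.single u.1 u.2 1) = mmCoord n (p, q, u) := by
  simp only [matMulTensor, mmCoord]
  by_cases h1 : p.2 = q.1
  · by_cases h2 : q.2 = u.1
    · rw [h1, h2]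
      by_cases h3 : u.2 = p.1
      · simp [h3]
      · simp [h3, Matrix.trace_single_eq_of_ne _ _ _ (Ne.symm h3)]
    · rw [h1]
      simp [h2]
  · simp [h1]

/-- The functional on big matrices induced by `F` positionwise. -/
noncomputable def bigFun (n k : ℕ) (F : Fin k → IdxP n → ℂ) :
    Matrix (Fin (n ^ k)) (Fin (n ^ k)) ℂ →ₗ[ℂ] ℂ :=
  ∑ p : Fin k → IdxP n, (∏ j, F j (p j)) •
    Matrix.entryLinearMap ℂ ℂ (finFunctionFinEquiv fun j => (p j).1)
      (finFunctionFinEquiv fun j => (p j).2)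

lemma matMul_expand (n k : ℕ) (A B C : Matrix (Fin (n ^ k)) (Fin (n ^ k)) ℂ) :
    matMulTensor (n ^ k) A B C = ∑ p : Fin k → IdxP n, ∑ q : Fin k → IdxP n,
      ∑ u : Fin k → IdxP n,
      A (finFunctionFinEquiv fun j => (p j).1) (finFunctionFinEquiv fun j => (p j).2) *
      B (finFunctionFinEquiv fun j => (q j).1) (finFunctionFinEquiv fun j => (q j).2) *
      C (finFunctionFinEquiv fun j => (u j).1) (finFunctionFinEquiv fun j => (u j).2) *
      ∏ j, mmCoord n (p j, q j, u j) := by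
  let E : (Fin k → Fin n) ≃ Fin (n ^ k) := finFunctionFinEquiv
  let T := (Equiv.arrowProdEquivProdArrow (Fin k) (fun _ => Fin n) (fun _ => Fin n)).symm
  have hprod : ∀ p q u : (Fin k → Fin n) × (Fin k → Fin n),
      ∏ j, mmCoord n (T p j, T q j, T u j) =
        if p.2 = q.1 then (if q.2 = u.1 then (if u.2 = p.1 then 1 else 0) else 0) else 0 := by
    intro p q u
    have e1 : ∀ j, mmCoord n (T p j, T q j, T u j) =
        if p.2 j = q.1 j ∧ q.2 j = u.1 j ∧ u.2 j = p.1 j then 1 else 0 := fun j => rfl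
    rw [Finset.prod_congr rfl fun j _ => e1 j, Fintype.prod_ite_zero, ← ite_and, ← ite_and]
    simp only [funext_iff, Finset.prod_const_one, forall_and, and_assoc]
  have hs : ∀ G : (Fin k → IdxP n) → ℂ, ∑ p, G p = ∑ x : Fin k → Fin n, ∑ y, G (T (x, y)) := by
    intro G
    rw [← Fintype.sum_prod_type', ← Equiv.sum_comp T]
  rw [hs]
  simp only [hs (fun q => ∑ u, _), hs (fun u => _ * ∏ j, mmCoord n (_, _, u j)), hprod]
  simp only [matMulTensor, Matrix.trace, Matrix.diag, Matrix.mul_apply]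
  rw [← Equiv.sum_comp E]
  refine Finset.sum_congr rfl fun x _ => ?_
  simp only [Finset.sum_mul]
  rw [Finset.sum_comm, ← Equiv.sum_comp E]
  refine Finset.sum_congr rfl fun y _ => ?_
  simp only [mul_ite, mul_one, mul_zero]
  rw [Finset.sum_comm, ← Equiv.sum_comp E]
  simp [Finset.sum_ite_eq, T, Equiv.arrowProdEquivProdArrow, E]

lemma sum_rearr {P X : Type*} [Fintype P] [Fintype X] (a b d : P → ℂ) (c : X → ℂ)
    (F G K : X → P → ℂ) :
    ∑ p, ∑ q, ∑ u, a p * b q * d u * ∑ x, c x * (F x p * G x q * K x u) =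
      ∑ x, (c x * ∑ p, F x p * a p) * (∑ q, G x q * b q) * (∑ u, K x u * d u) := by
  have h : ∀ x, (c x * ∑ p, F x p * a p) * (∑ q, G x q * b q) * (∑ u, K x u * d u) =
      ∑ p, ∑ q, ∑ u, a p * b q * d u * (c x * (F x p * G x q * K x u)) := by
    intro x
    rw [Finset.mul_sum _ (fun p => F x p * a p), Finset.sum_mul_sum, Finset.sum_mul]
    refine Finset.sum_congr rfl fun p _ => ?_
    rw [Finset.sum_mul_sum]
    refine Finset.sum_congr rfl fun q _ => Finset.sum_congr rfl fun u _ => ?_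
    ring
  simp only [h]
  symm
  rw [Finset.sum_comm]
  refine Finset.sum_congr rfl fun p _ => ?_
  rw [Finset.sum_comm]
  refine Finset.sum_congr rfl fun q _ => ?_
  rw [Finset.sum_comm]
  refine Finset.sum_congr rfl fun u _ => ?_
  rw [Finset.mul_sum]

lemma matMul_power {n r : ℕ} (h : HasBRk (matMulTensor n) r) (k : ℕ) :
    tensorRank (matMulTensor (n ^ k)) ≤
      (k + 1) ^ Fintype.card (IdxP n × IdxP n × IdxP n) * r ^ k := by
  obtain ⟨f, g, h, H⟩ := h
  let S : Set (IdxP n × IdxP n × IdxP n → ℂ) := {s | ∃ F G K : Fin r → IdxP n → ℂ,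
    ∀ p q u, s (p, q, u) = ∑ i, F i p * G i q * K i u}
  have hcl : mmCoord n ∈ closure S := by
    refine mem_closure_of_tendsto (b := atTop) (f := fun m d => ∑ i : Fin r,
      f m i (Matrix.single d.1.1 d.1.2 1) * g m i (Matrix.single d.2.1.1 d.2.1.2 1) *
      h m i (Matrix.single d.2.2.1 d.2.2.2 1)) ?_ (Eventually.of_forall fun m => ?_)
    · rw [tendsto_pi_nhds]
      rintro ⟨p, q, u⟩
      rw [← matMul_single]
      exact H _ _ _
    · exact ⟨fun i p => f m i (Matrix.single p.1 p.2 1),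
        fun i p => g m i (Matrix.single p.1 p.2 1),
        fun i p => h m i (Matrix.single p.1 p.2 1), fun p q u => rfl⟩
  obtain ⟨N, hN, c, s, hsS, hs⟩ := power_span S _ hcl k
  choose F G K hFGK using hsS
  refine le_trans ?_ (Nat.mul_le_mul_right _ hN)
  refine tensorRank_le (hasRk_of_fintype (κ := Fin N × (Fin k → Fin r)) (by simp)
    (fun x => c x.1 • bigFun n k (fun j => F x.1 (x.2 j)))
    (fun x => bigFun n k (fun j => G x.1 (x.2 j)))
    (fun x => bigFun n k (fun j => K x.1 (x.2 j))) fun A B C => ?_)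
  rw [matMul_expand]
  have hs' : ∀ p q u : Fin k → IdxP n, ∏ j, mmCoord n (p j, q j, u j) =
      ∑ x : Fin N × (Fin k → Fin r), c x.1 * ((∏ j, F x.1 (x.2 j) (p j)) *
        (∏ j, G x.1 (x.2 j) (q j)) * (∏ j, K x.1 (x.2 j) (u j))) := by
    intro p q u
    rw [hs (fun j => (p j, q j, u j)), Fintype.sum_prod_type]
    refine Finset.sum_congr rfl fun i _ => ?_
    simp only
    rw [← Finset.mul_sum]
    congr 1
    simp only [hFGK, ← Finset.prod_mul_distrib]
    rw [Finset.prod_univ_sum, Fintype.piFinset_univ]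
  simp only [hs', bigFun, LinearMap.smul_apply, LinearMap.sum_apply, smul_eq_mul,
    Matrix.entryLinearMap_apply]
  exact sum_rearr
    (fun p : Fin k → IdxP n => A (finFunctionFinEquiv fun j => (p j).1)
      (finFunctionFinEquiv fun j => (p j).2))
    (fun p : Fin k → IdxP n => B (finFunctionFinEquiv fun j => (p j).1)
      (finFunctionFinEquiv fun j => (p j).2))
    (fun p : Fin k → IdxP n => C (finFunctionFinEquiv fun j => (p j).1)
      (finFunctionFinEquiv fun j => (p j).2)) (fun x : Fin N × (Fin k → Fin r) => c x.1)
    (fun x p => ∏ j, F x.1 (x.2 j) (p j)) (fun x p => ∏ j, G x.1 (x.2 j) (p j))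
    (fun x p => ∏ j, K x.1 (x.2 j) (p j))

lemma log_nat_mono {a b : ℕ} (h : a ≤ b) : Real.log a ≤ Real.log b := by
  rcases Nat.eq_zero_or_pos a with rfl | ha
  · simpa using Real.log_natCast_nonneg b
  · exact Real.log_le_log (by exact_mod_cast ha) (by exact_mod_cast h)

lemma logRatio_nonneg (Q : ℕ → ℕ) (n : ℕ) : 0 ≤ Real.log (Q n) / Real.log n :=
  div_nonneg (Real.log_natCast_nonneg _) (Real.log_natCast_nonneg _)

lemma logRatio_bddBelow (Q : ℕ → ℕ) :
    IsBoundedUnder (· ≥ ·) atTop (fun n : ℕ => Real.log (Q n) / Real.log n) :=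
  isBoundedUnder_of ⟨0, fun n => logRatio_nonneg Q n⟩

lemma logRatio_bddAbove (Q : ℕ → ℕ) (hQ : ∀ n, Q n ≤ 4 * n ^ 3) :
    IsCoboundedUnder (· ≥ ·) atTop (fun n : ℕ => Real.log (Q n) / Real.log n) := by
  refine IsBoundedUnder.isCoboundedUnder_ge ⟨5, ?_⟩
  rw [eventually_map]
  filter_upwards [eventually_ge_atTop 2] with n hn
  have hlog : 0 < Real.log n := Real.log_pos (by exact_mod_cast hn)
  rw [div_le_iff₀ hlog]
  have h1 : Q n ≤ n ^ 5 := by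
    refine (hQ n).trans ?_
    have : 2 ^ 2 ≤ n ^ 2 := Nat.pow_le_pow_left hn 2
    calc 4 * n ^ 3 ≤ n ^ 2 * n ^ 3 := Nat.mul_le_mul_right _ this
      _ = n ^ 5 := by ring
  have h2 := log_nat_mono h1
  rw [Nat.cast_pow, Real.log_pow] at h2
  exact_mod_cast h2

/-- The exponent of matrix multiplication. -/
noncomputable def mmExp : ℝ :=
  Filter.liminf (fun n : ℕ => Real.log (tensorRank (matMulTensor n)) / Real.log n) atTop

lemma tendsto_log_natCast : Tendsto (fun n : ℕ => Real.log (n : ℝ)) atTop atTop :=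
  Real.tendsto_log_atTop.comp tendsto_natCast_atTop_atTop

lemma tendsto_const_div_log (c : ℝ) : Tendsto (fun n : ℕ => c / Real.log n) atTop (nhds 0) :=
  tendsto_log_natCast.const_div_atTop c

lemma matMul_rank_le (n : ℕ) : tensorRank (matMulTensor n) ≤ n ^ 3 :=
  tensorRank_le (matMul_hasRk n)

lemma mmExp_cobdd : IsCoboundedUnder (· ≥ ·) atTop
    (fun n : ℕ => Real.log (tensorRank (matMulTensor n)) / Real.log n) :=
  logRatio_bddAbove (fun n => tensorRank (matMulTensor n))
    (fun n => (matMul_rank_le n).trans (by omega))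

lemma mmExp_nonneg : 0 ≤ mmExp :=
  le_liminf_of_le mmExp_cobdd (Eventually.of_forall fun n =>
    logRatio_nonneg (fun n => tensorRank (matMulTensor n)) n)

lemma tendsto_log_succ_div : Tendsto (fun k : ℕ => Real.log ((k + 1 : ℕ) : ℝ) / k) atTop
    (nhds 0) := by
  have h1 : Tendsto (fun x : ℝ => Real.log x / x) atTop (nhds 0) :=
    Real.isLittleO_log_id_atTop.tendsto_div_nhds_zero
  have h2 : Tendsto (fun k : ℕ => Real.log ((k + 1 : ℕ) : ℝ) / ((k + 1 : ℕ) : ℝ)) atTop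
      (nhds 0) :=
    (h1.comp tendsto_natCast_atTop_atTop).comp (tendsto_add_atTop_nat 1)
  have h3 := h2.const_mul 2
  rw [mul_zero] at h3
  refine squeeze_zero' (Eventually.of_forall fun k =>
    div_nonneg (Real.log_natCast_nonneg _) (Nat.cast_nonneg k)) ?_ h3
  filter_upwards [eventually_ge_atTop 1] with k hk
  have hk' : (1 : ℝ) ≤ k := by exact_mod_cast hk
  have hl := Real.log_natCast_nonneg (k + 1)
  rw [← mul_div_assoc, div_le_div_iff₀ (by linarith) (by positivity)]
  push_cast at hl ⊢
  nlinarith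

lemma mmExp_le {n r : ℕ} (hn : 2 ≤ n) (h : HasBRk (matMulTensor n) r) :
    mmExp ≤ Real.log r / Real.log n := by
  refine le_of_forall_pos_le_add fun ε hε => ?_
  have hlog : 0 < Real.log n := Real.log_pos (by exact_mod_cast hn)
  refine liminf_le_of_frequently_le ?_ (logRatio_bddBelow fun n => tensorRank (matMulTensor n))
  have hpow : Tendsto (fun k : ℕ => n ^ k) atTop atTop :=
    tendsto_pow_atTop_atTop_of_one_lt (by omega)
  refine hpow.frequently (Eventually.frequently ?_)
  set d := Fintype.card (IdxP n × IdxP n × IdxP n)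
  have hlim := tendsto_log_succ_div.const_mul ((d : ℝ) / Real.log n)
  rw [mul_zero] at hlim
  filter_upwards [hlim.eventually (gt_mem_nhds hε), eventually_ge_atTop 1] with k hk hk1
  have hk' : (0 : ℝ) < k := by exact_mod_cast hk1
  have h1 := log_nat_mono (matMul_power h k)
  have h2 : Real.log (((k + 1) ^ d * r ^ k : ℕ) : ℝ) ≤
      d * Real.log ((k + 1 : ℕ) : ℝ) + k * Real.log r := by
    rcases Nat.eq_zero_or_pos r with rfl | hr
    · rw [zero_pow (by omega)]
      have := Real.log_natCast_nonneg (k + 1)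
      simp only [mul_zero, Nat.cast_zero, Real.log_zero, add_zero]
      positivity
    · rw [Nat.cast_mul, Nat.cast_pow, Nat.cast_pow, Real.log_mul (by positivity)
        (by positivity), Real.log_pow, Real.log_pow]
  have h3 := h1.trans h2
  have h4 : Real.log ((n ^ k : ℕ) : ℝ) = k * Real.log n := by
    rw [Nat.cast_pow, Real.log_pow]
  rw [h4, div_le_iff₀ (by positivity)]
  refine h3.trans ?_
  have h5 : (Real.log r / Real.log n + (d : ℝ) / Real.log n *
      (Real.log ((k + 1 : ℕ) : ℝ) / k)) * (k * Real.log n) =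
      d * Real.log ((k + 1 : ℕ) : ℝ) + k * Real.log r := by
    field_simp
    ring
  rw [← h5]
  exact mul_le_mul_of_nonneg_right (by linarith) (by positivity)

lemma liminf_eq_of_sandwich (Q : ℕ → ℕ) (h1 : ∀ n, borderRank (sMZTensor n) ≤ Q n)
    (h2 : ∀ n, Q n ≤ 4 * tensorRank (matMulTensor n)) :
    mmExp = Filter.liminf (fun n : ℕ => Real.log (Q n) / Real.log n) atTop := by
  have hco := logRatio_bddAbove Q (fun n => (h2 n).trans
    (Nat.mul_le_mul_left 4 (matMul_rank_le n)))
  apply le_antisymm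
  · refine le_of_forall_pos_le_add fun ε hε => ?_
    rw [← sub_le_iff_le_add]
    refine le_liminf_of_le hco ?_
    filter_upwards [(tendsto_const_div_log (mmExp * Real.log 6)).eventually (gt_mem_nhds hε),
      eventually_ge_atTop 6] with n hn hn6
    have hlog : 0 < Real.log n := Real.log_pos (by exact_mod_cast (by omega : 1 < n))
    have hB := borderRank_spec (sMZTensor_hasRk (matMul_hasRk n)).border
    have hM := matMul_border_of_sMZ (m := n / 3) (by omega) hB
    have hw := mmExp_le (by omega : 2 ≤ n / 3) hM
    have hlm : 0 < Real.log ((n / 3 : ℕ) : ℝ) :=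
      Real.log_pos (by exact_mod_cast (by omega : 1 < n / 3))
    rw [le_div_iff₀ hlm] at hw
    have hm : Real.log n ≤ Real.log 6 + Real.log ((n / 3 : ℕ) : ℝ) := by
      have h6 : n ≤ 6 * (n / 3) := by omega
      have := log_nat_mono h6
      rwa [Nat.cast_mul, Real.log_mul (by norm_num)
        (by exact_mod_cast (by omega : n / 3 ≠ 0))] at this
    have hQ := log_nat_mono (h1 n)
    rw [le_div_iff₀ hlog]
    rw [div_lt_iff₀ hlog] at hn
    have := mul_le_mul_of_nonneg_left hm mmExp_nonneg
    nlinarith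
  · refine le_of_forall_pos_le_add fun ε hε => ?_
    refine liminf_le_of_frequently_le ?_ (logRatio_bddBelow Q)
    have hfr := frequently_lt_of_liminf_lt mmExp_cobdd
      (show mmExp < mmExp + ε / 2 by linarith)
    refine (hfr.and_eventually (((tendsto_const_div_log (Real.log 4)).eventually
      (gt_mem_nhds (half_pos hε))).and (eventually_ge_atTop 2))).mono ?_
    rintro n ⟨ha, hb, hn⟩
    have hlog : 0 < Real.log n := Real.log_pos (by exact_mod_cast hn)
    have h3 : Real.log (Q n) ≤ Real.log 4 + Real.log (tensorRank (matMulTensor n)) := by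
      refine (log_nat_mono (h2 n)).trans ?_
      rcases Nat.eq_zero_or_pos (tensorRank (matMulTensor n)) with h0 | h0
      · rw [h0]
        simpa using Real.log_nonneg (by norm_num : (1 : ℝ) ≤ 4)
      · rw [Nat.cast_mul, Real.log_mul (by norm_num) (by positivity)]
        norm_num
    have h4 : Real.log (Q n) / Real.log n ≤
        Real.log 4 / Real.log n + Real.log (tensorRank (matMulTensor n)) / Real.log n := by
      rw [← add_div]
      exact div_le_div_of_nonneg_right h3 hlog.le
    linarith

theorem liminf_log_rank_sMZ_eq :
    Filter.liminf (fun n : ℕ => Real.log (tensorRank (matMulTensor n)) / Real.log n) atTop =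
      Filter.liminf (fun n : ℕ => Real.log (tensorRank (sMZTensor n)) / Real.log n) atTop ∧
    Filter.liminf (fun n : ℕ => Real.log (tensorRank (matMulTensor n)) / Real.log n) atTop =
      Filter.liminf (fun n : ℕ => Real.log (symRank (sMZ n)) / Real.log n) atTop ∧
    Filter.liminf (fun n : ℕ => Real.log (tensorRank (matMulTensor n)) / Real.log n) atTop =
      Filter.liminf (fun n : ℕ => Real.log (borderRank (sMZTensor n)) / Real.log n) atTop ∧
    Filter.liminf (fun n : ℕ => Real.log (tensorRank (matMulTensor n)) / Real.log n) atTop =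
      Filter.liminf (fun n : ℕ => Real.log (symBorderRank (sMZ n)) / Real.log n) atTop := by
  have hR : ∀ n, HasRk (matMulTensor n) (tensorRank (matMulTensor n)) :=
    fun n => tensorRank_spec (matMul_hasRk n)
  have hS : ∀ n, HasSRk (sMZ n) (4 * tensorRank (matMulTensor n)) := fun n => sMZ_hasSRk (hR n)
  have hT : ∀ n, HasRk (sMZTensor n) (2 * tensorRank (matMulTensor n)) :=
    fun n => sMZTensor_hasRk (hR n)
  have bT : ∀ n, borderRank (sMZTensor n) ≤ tensorRank (sMZTensor n) :=
    fun n => borderRank_le (tensorRank_spec (hT n)).border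
  have tR : ∀ n, tensorRank (sMZTensor n) ≤ 4 * tensorRank (matMulTensor n) :=
    fun n => (tensorRank_le (hT n)).trans (by omega)
  have bS : ∀ n, borderRank (sMZTensor n) ≤ symBorderRank (sMZ n) :=
    fun n => borderRank_le (sMZ_border_polar (symBorderRank_spec (hS n).border))
  have sS : ∀ n, symBorderRank (sMZ n) ≤ symRank (sMZ n) :=
    fun n => symBorderRank_le (symRank_spec (hS n)).border
  have sR : ∀ n, symRank (sMZ n) ≤ 4 * tensorRank (matMulTensor n) :=
    fun n => symRank_le (hS n)
  exact ⟨liminf_eq_of_sandwich _ bT tR,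
    liminf_eq_of_sandwich _ (fun n => (bS n).trans (sS n)) sR,
    liminf_eq_of_sandwich _ (fun n => le_rfl) (fun n => (bT n).trans (tR n)),
    liminf_eq_of_sandwich _ bS (fun n => (sS n).trans (sR n))⟩
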